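/- arXiv:1511.08364 — 4 statements merged into one kernel-verified Lean document; each statement's English description precedes it below -/
import Mathlib

section
/- Consider a discrete-time controlled system (S, U, F, ℓ) with ℓ(x,u) > 0 for all x, u, which is exponentially controllable with overshoot C ≥ 1 and decay rate σ ∈ (0,1). Fix a horizon N ≥ 2 and assume that for every state x there is a control sequence u^{*,x} attaining the infimum, J_N(x, u^{*,x}) = V_N(x); define the MPC feedback μ(x) = u^{*,x}_0 and the closed-loop trajectory x^μ_0 = x, x^μ_{n+1} = F(x^μ_n, μ(x^μ_n)), with infinite-horizon MPC cost J_∞^μ(x) = Σ_{n=0}^∞ ℓ(x^μ_n, μ(x^μ_n)) (a value in [0,∞]) and optimal infinite-horizon value V_∞(x) = inf over control sequences u of Σ_{n=0}^∞ ℓ(x_n, u_n). Let γ_i = C Σ_{n=0}^{i-1} σ^n and α_N = 1 − ((γ_N − 1)∏_{i=2}^N(γ_i − 1))/(∏_{i=2}^N γ_i − ∏_{i=2}^N(γ_i − 1)), and assume α_N > 0. Then α_N · V_∞(x) ≤ α_N · J_∞^μ(x) ≤ V_N(x) ≤ V_∞(x); in particular the MPC closed-loop cost is finite and satisfies J_∞^μ(x)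 ≤ (1/α_N) V_∞(x). -/
open Finset
open scoped ENNReal

/-- Trajectory of the discrete-time controlled system `x_{n+1} = F (x_n, u_n)`. -/
def traj {S U : Type*} (F : S → U → S) (x : S) (u : ℕ → U) : ℕ → S
  | 0 => x
  | n + 1 => F (traj F x u n) (u n)

/-- Closed-loop trajectory under a feedback law `μ : S → U`. -/
def closedLoop {S U : Type*} (F : S → U → S) (μ : S → U) (x : S) : ℕ → S
  | 0 => x
  | n + 1 => F (closedLoop F μ x n) (μ (closedLoop F μ x n))

/-- Finite-horizon cost `J_N(x,u) = Σ_{n=0}^{N-1} ℓ(x_n, u_n)`. -/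
noncomputable def costJ {S U : Type*} (F : S → U → S) (ℓ : S → U → ℝ)
    (N : ℕ) (x : S) (u : ℕ → U) : ℝ :=
  ∑ n ∈ Finset.range N, ℓ (traj F x u n) (u n)

/-- Finite-horizon value function `V_N(x) = inf_u J_N(x,u)`. -/
noncomputable def valueV {S U : Type*} (F : S → U → S) (ℓ : S → U → ℝ)
    (N : ℕ) (x : S) : ℝ :=
  ⨅ u : ℕ → U, costJ F ℓ N x u

/-- Pointwise optimal running cost `ℓ*(x) = inf_{u ∈ U} ℓ(x,u)`. -/
noncomputable def ellStar {S U : Type*} (ℓ : S → U → ℝ) (x : S) : ℝ :=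
  ⨅ u : U, ℓ x u

/-- Infinite-horizon closed-loop MPC cost `J_∞^μ(x)`, a value in `[0,∞]`. -/
noncomputable def costInfMPC {S U : Type*} (F : S → U → S) (ℓ : S → U → ℝ)
    (μ : S → U) (x : S) : ℝ≥0∞ :=
  ∑' n : ℕ, ENNReal.ofReal (ℓ (closedLoop F μ x n) (μ (closedLoop F μ x n)))

/-- Optimal infinite-horizon value `V_∞(x)`, a value in `[0,∞]`. -/
noncomputable def valueInf {S U : Type*} (F : S → U → S) (ℓ : S → U → ℝ)
    (x : S) : ℝ≥0∞ :=
  ⨅ u : ℕ → U, ∑' n : ℕ, ENNReal.ofReal (ℓ (traj F x u n) (u n))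

section MPC

variable {S U : Type*} {F : S → U → S} {ℓ : S → U → ℝ}

theorem traj_shift (x : S) (u : ℕ → U) (n : ℕ) :
    traj F (F x (u 0)) (fun i => u (i + 1)) n = traj F x u (n + 1) := by
  induction n with
  | zero => rfl
  | succ n ih => rw [traj, ih]; rfl

theorem costJ_succ (n : ℕ) (x : S) (u : ℕ → U) :
    costJ F ℓ (n + 1) x u = ℓ x (u 0) + costJ F ℓ n (F x (u 0)) (fun i => u (i + 1)) := by
  simp only [costJ, Finset.sum_range_succ', traj_shift]
  exact add_comm _ _

/-- Two controls can be concatenated after `k` steps. -/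
theorem exists_costJ_eq_add (k m : ℕ) (x : S) (u v : ℕ → U) :
    ∃ w : ℕ → U, costJ F ℓ (k + m) x w = costJ F ℓ k x u + costJ F ℓ m (traj F x u k) v := by
  induction k generalizing x u with
  | zero => exact ⟨v, by simp [costJ, traj]⟩
  | succ k ih =>
    obtain ⟨w, hw⟩ := ih (F x (u 0)) (fun i => u (i + 1))
    refine ⟨fun n => Nat.casesOn n (u 0) w, ?_⟩
    rw [Nat.add_right_comm, costJ_succ, costJ_succ, ← traj_shift]
    exact (congrArg (ℓ x (u 0) + ·) hw).trans (add_assoc _ _ _).symm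

theorem costJ_nonneg (hℓ : ∀ x u, 0 ≤ ℓ x u) (n : ℕ) (x : S) (u : ℕ → U) :
    0 ≤ costJ F ℓ n x u :=
  Finset.sum_nonneg fun _ _ => hℓ _ _

theorem valueV_le_costJ (hℓ : ∀ x u, 0 ≤ ℓ x u) (n : ℕ) (x : S) (u : ℕ → U) :
    valueV F ℓ n x ≤ costJ F ℓ n x u :=
  ciInf_le ⟨0, Set.forall_mem_range.2 (costJ_nonneg hℓ n x)⟩ u

theorem valueV_nonneg (hℓ : ∀ x u, 0 ≤ ℓ x u) (n : ℕ) (x : S) : 0 ≤ valueV F ℓ n x :=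
  Real.iInf_nonneg (costJ_nonneg hℓ n x)

theorem ellStar_le (hℓ : ∀ x u, 0 ≤ ℓ x u) (x : S) (u : U) : ellStar ℓ x ≤ ℓ x u :=
  ciInf_le ⟨0, Set.forall_mem_range.2 (hℓ x)⟩ u

/-- Following `u` for `k` steps and an exponentially controlling sequence for `m` more steps. -/
theorem valueV_add_le (hℓ : ∀ x u, 0 ≤ ℓ x u) {C σ : ℝ} (hC : 0 ≤ C) (hσ : 0 ≤ σ)
    (hexp : ∀ x : S, ∃ u : ℕ → U,
      ∀ n : ℕ, ℓ (traj F x u n) (u n) ≤ C * σ ^ n * ellStar ℓ x)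
    (k m : ℕ) (x : S) (u : ℕ → U) :
    valueV F ℓ (k + m) x ≤
      costJ F ℓ k x u + C * (∑ n ∈ Finset.range m, σ ^ n) * ℓ (traj F x u k) (u k) := by
  obtain ⟨v, hv⟩ := hexp (traj F x u k)
  obtain ⟨w, hw⟩ := exists_costJ_eq_add (F := F) (ℓ := ℓ) k m x u v
  refine (valueV_le_costJ hℓ _ x w).trans (hw.le.trans (add_le_add_right ?_ _))
  rw [Finset.mul_sum, Finset.sum_mul]
  refine Finset.sum_le_sum fun n _ => (hv n).trans ?_
  exact mul_le_mul_of_nonneg_left (ellStar_le hℓ _ _) (by positivity)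

/-- Elimination of the tail sums `b` from the chain of linear constraints. -/
theorem mul_prod_sub_prod_le (γ b : ℕ → ℝ) (D : ℝ) (hγ : ∀ i, 1 ≤ i → 1 ≤ γ i) (hb : b 1 = 0)
    (n : ℕ) (h : ∀ m, 1 ≤ m → m < n →
      D ≤ (γ (m + 1) - 1) * b (m + 1) - γ (m + 1) * b m) (hn : 1 ≤ n) :
    D * (∏ i ∈ Finset.Icc 2 n, γ i - ∏ i ∈ Finset.Icc 2 n, (γ i - 1)) ≤
      (∏ i ∈ Finset.Icc 2 n, (γ i - 1)) * b n := by
  induction n, hn using Nat.le_induction with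
  | base => simp [hb]
  | succ m hm ih =>
    have ih := ih fun i hi him => h i hi (him.trans (Nat.lt_succ_self m))
    have hD := h m hm (Nat.lt_succ_self m)
    have hQ : 0 ≤ ∏ i ∈ Finset.Icc 2 m, (γ i - 1) :=
      Finset.prod_nonneg fun i hi =>
        sub_nonneg.2 (hγ i (one_le_two.trans (Finset.mem_Icc.1 hi).1))
    have hγm : 0 ≤ γ (m + 1) := zero_le_one.trans (hγ _ (Nat.le_add_left 1 m))
    rw [Finset.prod_Icc_succ_top (by lia), Finset.prod_Icc_succ_top (by lia)]
    have h₁ := mul_le_mul_of_nonneg_left hD hQ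
    have h₂ := mul_le_mul_of_nonneg_left ih hγm
    linarith

theorem prod_sub_one_lt_prod (γ : ℕ → ℝ) (n : ℕ) (hn : 2 ≤ n) (hγ : ∀ i, 2 ≤ i → 1 < γ i) :
    ∏ i ∈ Finset.Icc 2 n, (γ i - 1) < ∏ i ∈ Finset.Icc 2 n, γ i :=
  Finset.prod_lt_prod_of_nonempty
    (fun i hi => sub_pos.2 (hγ i (Finset.mem_Icc.1 hi).1)) (fun _ _ => sub_one_lt _)
    (Finset.nonempty_Icc.2 hn)

/-- Relaxed dynamic programming inequality along one step of an optimal control. -/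
theorem valueV_step_add_le (hℓ : ∀ x u, 0 ≤ ℓ x u) {C σ : ℝ} (hC : 1 ≤ C) (hσ : 0 < σ)
    (hexp : ∀ x : S, ∃ u : ℕ → U,
      ∀ n : ℕ, ℓ (traj F x u n) (u n) ≤ C * σ ^ n * ellStar ℓ x)
    {N : ℕ} (hN : 2 ≤ N) (γ : ℕ → ℝ) (hγ : ∀ i, γ i = C * ∑ n ∈ Finset.range i, σ ^ n)
    (x : S) (u : ℕ → U) (hu : costJ F ℓ N x u = valueV F ℓ N x) :
    valueV F ℓ N (F x (u 0)) + (1 - ((γ N - 1) * ∏ i ∈ Finset.Icc 2 N, (γ i - 1)) /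
      ((∏ i ∈ Finset.Icc 2 N, γ i) - ∏ i ∈ Finset.Icc 2 N, (γ i - 1))) * ℓ x (u 0) ≤
      valueV F ℓ N x := by
  have hγ_one : ∀ i, 1 ≤ i → 1 ≤ γ i := by
    intro i hi
    obtain ⟨j, rfl⟩ := Nat.exists_eq_add_of_le' hi
    rw [hγ, Finset.sum_range_succ', pow_zero]
    have : 0 ≤ ∑ n ∈ Finset.range j, σ ^ (n + 1) := Finset.sum_nonneg fun _ _ => by positivity
    nlinarith
  have hγ_two : ∀ i, 2 ≤ i → 1 < γ i := by
    intro i hi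
    obtain ⟨j, rfl⟩ := Nat.exists_eq_add_of_le' hi
    rw [hγ, Finset.sum_range_succ', Finset.sum_range_succ', pow_zero]
    have : 0 ≤ ∑ n ∈ Finset.range j, σ ^ (n + 1 + 1) :=
      Finset.sum_nonneg fun _ _ => by positivity
    simp only [zero_add, pow_one]
    nlinarith
  have hpos := sub_pos.2 (prod_sub_one_lt_prod γ N hN hγ_two)
  have hQ : 0 ≤ ∏ i ∈ Finset.Icc 2 N, (γ i - 1) :=
    Finset.prod_nonneg fun i hi => (sub_pos.2 (hγ_two i (Finset.mem_Icc.1 hi).1)).le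
  have hchain := mul_prod_sub_prod_le γ
    (fun m => costJ F ℓ N x u - costJ F ℓ (N + 1 - m) x u)
    (valueV F ℓ N (F x (u 0)) - (costJ F ℓ N x u - ℓ x (u 0))) hγ_one (by simp) N
    (by
      intro m hm hmN
      obtain ⟨k, rfl⟩ : ∃ k, N = k + (m + 1) := Nat.exists_eq_add_of_le' hmN
      have h := valueV_add_le hℓ (zero_le_one.trans hC) hσ.le hexp k (m + 1) (F x (u 0))
        (fun i => u (i + 1))
      rw [← hγ, traj_shift] at h
      have h₁ := costJ_succ (F := F) (ℓ := ℓ) k x u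
      have h₂ : costJ F ℓ (k + 1 + 1) x u =
        costJ F ℓ (k + 1) x u + ℓ (traj F x u (k + 1)) (u (k + 1)) := Finset.sum_range_succ _ _
      have e₁ : k + (m + 1) + 1 - (m + 1) = k + 1 := by lia
      have e₂ : k + (m + 1) + 1 - m = k + 1 + 1 := by lia
      simp only [e₁, e₂]
      rw [h₂]
      linarith)
    (by lia)
  have hone : costJ F ℓ 1 x u = ℓ x (u 0) := by simp [costJ, traj]
  have htop : costJ F ℓ N x u ≤ γ N * ℓ x (u 0) := by
    have h := valueV_add_le hℓ (zero_le_one.trans hC) hσ.le hexp 0 N x u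
    rw [← hγ, zero_add] at h
    rw [hu]
    simpa [costJ, traj] using h
  simp only [Nat.add_sub_cancel_left, hone] at hchain
  have hD : valueV F ℓ N (F x (u 0)) - (costJ F ℓ N x u - ℓ x (u 0)) ≤
      ((γ N - 1) * ∏ i ∈ Finset.Icc 2 N, (γ i - 1)) /
      ((∏ i ∈ Finset.Icc 2 N, γ i) - ∏ i ∈ Finset.Icc 2 N, (γ i - 1)) * ℓ x (u 0) := by
    rw [div_mul_eq_mul_div, le_div_iff₀ hpos]
    refine hchain.trans ?_
    calc (∏ i ∈ Finset.Icc 2 N, (γ i - 1)) * (costJ F ℓ N x u - ℓ x (u 0))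
        ≤ (∏ i ∈ Finset.Icc 2 N, (γ i - 1)) * (γ N * ℓ x (u 0) - ℓ x (u 0)) := by gcongr
      _ = (γ N - 1) * (∏ i ∈ Finset.Icc 2 N, (γ i - 1)) * ℓ x (u 0) := by ring
  linarith

theorem traj_closedLoop (μ : S → U) (x : S) (n : ℕ) :
    traj F x (fun i => μ (closedLoop F μ x i)) n = closedLoop F μ x n := by
  induction n with
  | zero => rfl
  | succ n ih => rw [traj, ih, closedLoop]

theorem valueInf_le_costInfMPC (μ : S → U) (x : S) :
    valueInf F ℓ x ≤ costInfMPC F ℓ μ x := by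
  refine (iInf_le _ fun i => μ (closedLoop F μ x i)).trans_eq ?_
  simp only [traj_closedLoop, costInfMPC]

theorem ofReal_valueV_le_valueInf (hℓ : ∀ x u, 0 ≤ ℓ x u) (N : ℕ) (x : S) :
    ENNReal.ofReal (valueV F ℓ N x) ≤ valueInf F ℓ x := by
  refine le_iInf fun u => (ENNReal.ofReal_le_ofReal (valueV_le_costJ hℓ N x u)).trans ?_
  rw [costJ, ENNReal.ofReal_sum_of_nonneg fun _ _ => hℓ _ _]
  exact ENNReal.sum_le_tsum _

/-- A nonnegative `V` decreasing by at least `a * ℓ` along the closed loop bounds its cost. -/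
theorem ofReal_mul_costInfMPC_le (hℓ : ∀ x u, 0 ≤ ℓ x u) {a : ℝ} (ha : 0 ≤ a) (μ : S → U)
    (V : S → ℝ) (hV : ∀ x, 0 ≤ V x) (hstep : ∀ x, V (F x (μ x)) + a * ℓ x (μ x) ≤ V x) (x : S) :
    ENNReal.ofReal a * costInfMPC F ℓ μ x ≤ ENNReal.ofReal (V x) := by
  rw [costInfMPC, ← ENNReal.tsum_mul_left]
  refine ENNReal.tsum_le_of_sum_range_le fun M => ?_
  simp only [← ENNReal.ofReal_mul ha]
  rw [← ENNReal.ofReal_sum_of_nonneg fun _ _ => mul_nonneg ha (hℓ _ _)]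
  refine ENNReal.ofReal_le_ofReal ?_
  have key : ∑ n ∈ Finset.range M, a * ℓ (closedLoop F μ x n) (μ (closedLoop F μ x n)) ≤
      V x - V (closedLoop F μ x M) := by
    induction M with
    | zero => simp [closedLoop]
    | succ M ih =>
      rw [Finset.sum_range_succ, closedLoop]
      linarith [hstep (closedLoop F μ x M)]
  linarith [hV (closedLoop F μ x M)]

end MPC

/-- Finite-agent MPC performance estimate (estimate (1.11), after Grüne, Theorem 4.2):
`α_N V_∞(x) ≤ α_N J_∞^μ(x) ≤ V_N(x) ≤ V_∞(x)`, and in particular the closed-loop cost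
is finite with `J_∞^μ(x) ≤ (1/α_N) V_∞(x)`. -/
theorem mpc_performance_bound
    {S U : Type*} [Nonempty U] (F : S → U → S) (ℓ : S → U → ℝ)
    (hℓpos : ∀ x u, 0 < ℓ x u)
    (C σ : ℝ) (hC : 1 ≤ C) (hσ0 : 0 < σ) (hσ1 : σ < 1)
    (hexp : ∀ x : S, ∃ u : ℕ → U,
      ∀ n : ℕ, ℓ (traj F x u n) (u n) ≤ C * σ ^ n * ellStar ℓ x)
    (N : ℕ) (hN : 2 ≤ N)
    (ustar : S → ℕ → U)
    (hopt : ∀ x : S, costJ F ℓ N x (ustar x) = valueV F ℓ N x)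
    (μ : S → U) (hμ : ∀ x : S, μ x = ustar x 0)
    (γ : ℕ → ℝ) (hγ : ∀ i, γ i = C * ∑ n ∈ Finset.range i, σ ^ n)
    (αN : ℝ)
    (hαN : αN = 1 - ((γ N - 1) * ∏ i ∈ Finset.Icc 2 N, (γ i - 1)) /
      ((∏ i ∈ Finset.Icc 2 N, γ i) - ∏ i ∈ Finset.Icc 2 N, (γ i - 1)))
    (hαpos : 0 < αN) (x : S) :
    ENNReal.ofReal αN * valueInf F ℓ x ≤ ENNReal.ofReal αN * costInfMPC F ℓ μ x ∧
    ENNReal.ofReal αN * costInfMPC F ℓ μ x ≤ ENNReal.ofReal (valueV F ℓ N x) ∧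
    ENNReal.ofReal (valueV F ℓ N x) ≤ valueInf F ℓ x ∧
    costInfMPC F ℓ μ x < ⊤ ∧
    costInfMPC F ℓ μ x ≤ ENNReal.ofReal (1 / αN) * valueInf F ℓ x := by
  have hℓ : ∀ x u, 0 ≤ ℓ x u := fun x u => (hℓpos x u).le
  have hmpc : ENNReal.ofReal αN * costInfMPC F ℓ μ x ≤ ENNReal.ofReal (valueV F ℓ N x) := by
    refine ofReal_mul_costInfMPC_le hℓ hαpos.le μ _ (valueV_nonneg hℓ N) (fun y => ?_) x
    rw [hμ, hαN]
    exact valueV_step_add_le hℓ hC hσ0 hexp hN γ hγ y (ustar y) (hopt y)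
  have hV := ofReal_valueV_le_valueInf (F := F) hℓ N x
  have hα : ENNReal.ofReal αN ≠ 0 := (ENNReal.ofReal_pos.2 hαpos).ne'
  refine ⟨mul_le_mul_right (valueInf_le_costInfMPC μ x) _, hmpc, hV, ?_, ?_⟩
  · exact ENNReal.lt_top_of_mul_ne_top_right (hmpc.trans_lt ENNReal.ofReal_lt_top).ne hα
  · have h := mul_le_mul_right (hmpc.trans hV) (ENNReal.ofReal (1 / αN))
    rwa [← mul_assoc, ← ENNReal.ofReal_mul (one_div_nonneg.2 hαpos.le),
      one_div_mul_cancel hαpos.ne', ENNReal.ofReal_one, one_mul] at h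
end

section
/- Let C ≥ 1, σ ∈ (0,1) and let N ≥ 2 be an integer. Set γ_i = C Σ_{n=0}^{i-1} σ^n for i ≥ 1 and α_N = 1 − ((γ_N − 1)∏_{i=2}^N(γ_i − 1))/(∏_{i=2}^N γ_i − ∏_{i=2}^N(γ_i − 1)), and assume α_N > 0. Let λ_0, …, λ_{N-1} be positive real numbers and ν > 0 a real number satisfying: (i) Σ_{n=k}^{N-1} λ_n ≤ C λ_k (1 − σ^{N-k})/(1 − σ) for every k = 0, …, N−2, and (ii) ν ≤ Σ_{n=0}^{j-1} λ_{n+1} + C λ_{j+1} (1 − σ^{N-j})/(1 − σ) for every j = 0, …, N−2. Then Σ_{n=0}^{N-1} λ_n − ν ≥ λ_0 · α_N. -/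
open Finset

/-- Telescoping a family of recursive upper bounds on `x` with product weights. -/
theorem prod_sub_prod_mul_le {g T : ℕ → ℝ} {x : ℝ} {m : ℕ} (hm : 1 ≤ m)
    (hg : ∀ i ∈ Icc 2 m, 1 ≤ g i) (hT : 0 ≤ T 1)
    (h : ∀ i, 1 ≤ i → i < m → x ≤ (g (i + 1) - 1) * T (i + 1) - g (i + 1) * T i) :
    ((∏ i ∈ Icc 2 m, g i) - ∏ i ∈ Icc 2 m, (g i - 1)) * x ≤
      (∏ i ∈ Icc 2 m, (g i - 1)) * T m := by
  induction m, hm using Nat.le_induction with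
  | base => simpa using hT
  | succ m hm ih =>
    have hg' : ∀ i ∈ Icc 2 m, 1 ≤ g i := fun i hi =>
      hg i (Icc_subset_Icc_right m.le_succ hi)
    have ih := ih hg' fun i hi him => h i hi (by omega)
    have hlast := h m hm m.lt_succ_self
    have hgm : 1 ≤ g (m + 1) := hg _ (by simp; omega)
    have hQ : 0 ≤ ∏ i ∈ Icc 2 m, (g i - 1) :=
      prod_nonneg fun i hi => sub_nonneg.2 (hg' i hi)
    rw [prod_Icc_succ_top (by omega), prod_Icc_succ_top (by omega)]
    have h1 := mul_le_mul_of_nonneg_left ih (zero_le_one.trans hgm)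
    have h2 := mul_le_mul_of_nonneg_left hlast hQ
    linarith

/-- The partial sums of the exponential bound exceed `1` from the second one on. -/
theorem one_lt_mul_geom_sum {C σ : ℝ} (hC : 1 ≤ C) (hσ : 0 < σ) {i : ℕ} (hi : 2 ≤ i) :
    1 < C * ∑ n ∈ range i, σ ^ n := by
  have h : ∑ n ∈ range 2, σ ^ n ≤ ∑ n ∈ range i, σ ^ n :=
    sum_le_sum_of_subset_of_nonneg (range_subset_range.2 hi) fun _ _ _ => by positivity
  simp only [sum_range_succ, sum_range_zero, pow_zero, pow_one, zero_add] at h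
  nlinarith

/-- Lemma 3.3 (after Grüne–Pannek–Seehafer, Theorem 5.4): for the exponential
controllability bound `β(r,n) = C σ^n r`, the explicit value `α_N` is a valid
suboptimality degree: any positive data `(λ_n)`, `ν` satisfying the constraints
(4.2) and (4.1) fulfill `Σ λ_n − ν ≥ λ_0 α_N`. -/
theorem alphaN_suboptimality_degree
    (C σ : ℝ) (hC : 1 ≤ C) (hσ0 : 0 < σ) (hσ1 : σ < 1)
    (N : ℕ) (hN : 2 ≤ N)
    (γ : ℕ → ℝ) (hγ : ∀ i, γ i = C * ∑ n ∈ Finset.range i, σ ^ n)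
    (αN : ℝ)
    (hαN : αN = 1 - ((γ N - 1) * ∏ i ∈ Finset.Icc 2 N, (γ i - 1)) /
      ((∏ i ∈ Finset.Icc 2 N, γ i) - ∏ i ∈ Finset.Icc 2 N, (γ i - 1)))
    (hαpos : 0 < αN)
    (lam : ℕ → ℝ) (hlam : ∀ n < N, 0 < lam n)
    (ν : ℝ) (hν : 0 < ν)
    (h42 : ∀ k < N - 1,
      ∑ n ∈ Finset.Ico k N, lam n ≤ C * lam k * (1 - σ ^ (N - k)) / (1 - σ))
    (h41 : ∀ j < N - 1,
      ν ≤ (∑ n ∈ Finset.range j, lam (n + 1)) +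
        C * lam (j + 1) * (1 - σ ^ (N - j)) / (1 - σ)) :
    (∑ n ∈ Finset.range N, lam n) - ν ≥ lam 0 * αN := by
  have hγ1 : ∀ i ∈ Icc 2 N, 1 < γ i := fun i hi =>
    hγ i ▸ one_lt_mul_geom_sum hC hσ0 (mem_Icc.1 hi).1
  have hγeq : ∀ (a : ℝ) (i : ℕ), C * a * (1 - σ ^ i) / (1 - σ) = γ i * a := by
    intro a i
    have h1 : σ - 1 ≠ 0 := by linarith
    have h2 : 1 - σ ≠ 0 := by linarith
    rw [hγ, geom_sum_eq hσ1.ne]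
    field_simp
    ring
  have hsplit : ∀ k < N, ∑ n ∈ Ico k N, lam n = lam k + ∑ n ∈ Ico (k + 1) N, lam n :=
    fun k hk => sum_eq_sum_Ico_succ_bot hk lam
  have hrec : ∀ i, 1 ≤ i → i < N → ν - ∑ n ∈ Ico 1 N, lam n ≤
      (γ (i + 1) - 1) * ∑ n ∈ Ico (N + 1 - (i + 1)) N, lam n -
        γ (i + 1) * ∑ n ∈ Ico (N + 1 - i) N, lam n := by
    intro i hi hiN
    obtain ⟨j, hj⟩ : ∃ j, N = j + (i + 1) := ⟨N - (i + 1), by omega⟩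
    have h := h41 j (by omega)
    rw [hγeq, show N - j = i + 1 by omega] at h
    have hsum : ∑ n ∈ range j, lam (n + 1) = ∑ n ∈ Ico 1 (j + 1), lam n := by
      rw [range_eq_Ico, sum_Ico_add' lam 0 j 1]
    have hcat := sum_Ico_consecutive lam (show 1 ≤ j + 1 by omega) (show j + 1 ≤ N by omega)
    rw [show N + 1 - (i + 1) = j + 1 by omega, show N + 1 - i = j + 1 + 1 by omega]
    have hs := hsplit (j + 1) (by omega)
    rw [hs] at hcat ⊢
    linarith
  have hmain := prod_sub_prod_mul_le (m := N) (g := γ) (x := ν - ∑ n ∈ Ico 1 N, lam n)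
    (T := fun i => ∑ n ∈ Ico (N + 1 - i) N, lam n) (by omega)
    (fun i hi => (hγ1 i hi).le) (by simp) hrec
  have hfirst := h42 0 (by omega)
  have hs := hsplit 0 (by omega)
  rw [hγeq, hs] at hfirst
  simp only [zero_add, Nat.sub_zero, Nat.add_sub_cancel_left] at hfirst hmain hs
  have hPQ : ∏ i ∈ Icc 2 N, (γ i - 1) < ∏ i ∈ Icc 2 N, γ i :=
    prod_lt_prod_of_nonempty (fun i hi => sub_pos.2 (hγ1 i hi)) (fun i _ => by linarith)
      (nonempty_Icc.2 hN)
  have hQ : 0 ≤ ∏ i ∈ Icc 2 N, (γ i - 1) :=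
    prod_nonneg fun i hi => (sub_pos.2 (hγ1 i hi)).le
  have hbound : ν - ∑ n ∈ Ico 1 N, lam n ≤
      lam 0 * (((γ N - 1) * ∏ i ∈ Icc 2 N, (γ i - 1)) /
        ((∏ i ∈ Icc 2 N, γ i) - ∏ i ∈ Icc 2 N, (γ i - 1))) := by
    rw [← mul_div_assoc, le_div_iff₀ (sub_pos.2 hPQ)]
    have := mul_le_mul_of_nonneg_left
      (show ∑ n ∈ Ico 1 N, lam n ≤ (γ N - 1) * lam 0 by linarith) hQ
    linarith
  rw [hαN, range_eq_Ico, hs]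
  linarith
end

section
/- Let Q ⊆ ℝ be a nonempty compact set. For probability measures μ, ν on Q, let d_1(μ,ν) = sup { ∫ φ dμ − ∫ φ dν : φ : Q → ℝ is 1-Lipschitz } be the Kantorovich–Rubinstein distance, and for X = (x_1,…,x_M) ∈ Q^M let m^M_X = (1/M) Σ_{i=1}^M δ_{x_i} be the empirical measure. Let u_M : Q^M → ℝ be a sequence of functions such that: (i) each u_M is symmetric, i.e. u_M(x_1,…,x_M) = u_M(x_{σ(1)},…,x_{σ(M)}) for every permutation σ of {1,…,M}; (ii) there is a constant C with |u_M(X)| ≤ C for all M and all X ∈ Q^M; and (iii) there is a nondecreasing function ω : [0,∞) → [0,∞) with ω(0) = 0, continuous at 0, independent of M, such that |u_M(X) − u_M(Y)| ≤ ω(d_1(m^M_X, m^M_Y)) for all X, Y ∈ Q^M and all M. Then there exist a strictly increasing sequence (M_k) of indices and a continuous map U from the space of probability measures on Q (with the topology of weak convergence) to ℝ such that sup_{X ∈ Q^{M_k}} |u_{M_k}(X) − U(m^{M_k}_X)| → 0 as k → ∞. -/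
open MeasureTheory Filter
open scoped ENNReal

/-- The empirical measure `m^M_X = (1/M) Σ_{i=1}^M δ_{x_i}` of `M = M'+1` points. -/
noncomputable def empiricalMeasure {Ω : Type*} [MeasurableSpace Ω] {M : ℕ}
    (X : Fin (M + 1) → Ω) : Measure Ω :=
  (((M : ℕ) + 1 : ℝ≥0∞))⁻¹ • ∑ i, Measure.dirac (X i)

theorem empiricalMeasure_isProbabilityMeasure {Ω : Type*} [MeasurableSpace Ω]
    {M : ℕ} (X : Fin (M + 1) → Ω) :
    IsProbabilityMeasure (empiricalMeasure X) := by
  constructor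
  have h : (∑ i, Measure.dirac (X i) : Measure Ω) Set.univ = (M + 1 : ℝ≥0∞) := by
    rw [Measure.finset_sum_apply]
    simp
  simp only [empiricalMeasure, Measure.smul_apply, smul_eq_mul, h]
  rw [ENNReal.inv_mul_cancel]
  · simp
  · exact ENNReal.add_ne_top.mpr ⟨ENNReal.natCast_ne_top M, ENNReal.one_ne_top⟩

/-- The empirical measure as a probability measure. -/
noncomputable def empiricalProb {Ω : Type*} [MeasurableSpace Ω] {M : ℕ}
    (X : Fin (M + 1) → Ω) : ProbabilityMeasure Ω :=
  ⟨empiricalMeasure X, empiricalMeasure_isProbabilityMeasure X⟩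

/-- The Kantorovich–Rubinstein distance
`d₁(μ,ν) = sup { ∫ φ dμ − ∫ φ dν : φ 1-Lipschitz }`. -/
noncomputable def krDist {Ω : Type*} [MeasurableSpace Ω] [PseudoMetricSpace Ω]
    (μ ν : ProbabilityMeasure Ω) : ℝ :=
  ⨆ φ : {f : Ω → ℝ // LipschitzWith 1 f},
    ((∫ x, φ.1 x ∂(μ : Measure Ω)) - ∫ x, φ.1 x ∂(ν : Measure Ω))

open scoped Topology BoundedContinuousFunction

section EmpiricalMeasure

variable {Ω : Type*} [MeasurableSpace Ω]

theorem integral_empiricalProb {M : ℕ} (X : Fin (M + 1) → Ω) {f : Ω → ℝ}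
    (hf : StronglyMeasurable f) :
    ∫ x, f x ∂(empiricalProb X : Measure Ω) = (∑ i, f (X i)) / ((M + 1 : ℕ) : ℝ) := by
  change ∫ x, f x ∂(empiricalMeasure X) = _
  rw [empiricalMeasure, integral_smul_measure,
    integral_finsetSum_measure fun i _ => integrable_dirac' hf (by simp)]
  simp only [integral_dirac' _ _ hf, smul_eq_mul, ENNReal.toReal_inv]
  rw [ENNReal.toReal_add (by simp) (by simp), div_eq_inv_mul]
  simp

end EmpiricalMeasure

theorem separableSpace_boundedContinuousFunction (Ω : Type*) [MetricSpace Ω]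
    [CompactSpace Ω] : TopologicalSpace.SeparableSpace (Ω →ᵇ ℝ) :=
  (ContinuousMap.isometryEquivBoundedOfCompact Ω ℝ).surjective.denseRange.separableSpace
    (ContinuousMap.isometryEquivBoundedOfCompact Ω ℝ).continuous

theorem isCompact_setOf_lipschitzWith_one {Ω : Type*} [MetricSpace Ω]
    [CompactSpace Ω] (x₀ : Ω) :
    IsCompact {f : Ω →ᵇ ℝ | LipschitzWith 1 f ∧ f x₀ = 0} := by
  refine BoundedContinuousFunction.arzela_ascoli₂
    (Metric.closedBall 0 (Metric.diam (Set.univ : Set Ω))) (isCompact_closedBall _ _) _ ?_ ?_ ?_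
  · have hlip : IsClosed {f : Ω →ᵇ ℝ | LipschitzWith 1 f} :=
      (isClosed_setOfPred_lipschitzWith (α := Ω) (β := ℝ) 1).preimage
        BoundedContinuousFunction.continuous_coe
    have hzero : IsClosed {f : Ω →ᵇ ℝ | f x₀ = 0} :=
      isClosed_eq (continuous_eval_const x₀) continuous_const
    exact hlip.inter hzero
  · rintro f x ⟨hf, hf₀⟩
    have h := hf.dist_le_mul x x₀
    rw [hf₀, NNReal.coe_one, one_mul] at h
    exact h.trans (Metric.dist_le_diam_of_mem isCompact_univ.isBounded trivial trivial)
  · exact (LipschitzWith.uniformEquicontinuous _ 1 fun f => f.2.1).equicontinuous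

section Measurable

variable {Ω : Type*} [MeasurableSpace Ω]

theorem krDist_le [PseudoMetricSpace Ω] {μ ν : ProbabilityMeasure Ω} {c : ℝ}
    (h : ∀ φ : Ω → ℝ, LipschitzWith 1 φ →
      (∫ x, φ x ∂(μ : Measure Ω)) - ∫ x, φ x ∂(ν : Measure Ω) ≤ c) : krDist μ ν ≤ c := by
  have : Nonempty {f : Ω → ℝ // LipschitzWith 1 f} :=
    ⟨fun _ => 0, (LipschitzWith.const 0).weaken zero_le_one⟩
  exact ciSup_le fun φ => h φ.1 φ.2

theorem lipschitzWith_integral_boundedContinuousFunction [TopologicalSpace Ω]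
    [OpensMeasurableSpace Ω] (μ : ProbabilityMeasure Ω) :
    LipschitzWith 1 fun f : Ω →ᵇ ℝ => ∫ x, f x ∂(μ : Measure Ω) := by
  refine LipschitzWith.of_dist_le_mul fun f g => ?_
  rw [NNReal.coe_one, one_mul, dist_eq_norm, dist_eq_norm,
    ← integral_sub (f.integrable _) (g.integrable _)]
  simpa using (f - g).norm_integral_le_norm (μ : Measure Ω)

theorem continuous_integral_probabilityMeasure_prod [TopologicalSpace Ω]
    [OpensMeasurableSpace Ω] :
    Continuous fun p : ProbabilityMeasure Ω × (Ω →ᵇ ℝ) => ∫ x, p.2 x ∂(p.1 : Measure Ω) :=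
  continuous_prod_of_continuous_lipschitzWith' _ 1
    lipschitzWith_integral_boundedContinuousFunction fun f =>
      ProbabilityMeasure.continuous_integral_boundedContinuousFunction f

end Measurable

section CompactMetric

variable {Ω : Type*} [MeasurableSpace Ω] [MetricSpace Ω] [CompactSpace Ω] [BorelSpace Ω]

theorem integrable_of_continuous_of_compactSpace (μ : ProbabilityMeasure Ω) {f : Ω → ℝ}
    (hf : Continuous f) : Integrable f (μ : Measure Ω) :=
  (BoundedContinuousFunction.mkOfCompact ⟨f, hf⟩).integrable _

theorem bddAbove_range_integral_sub_integral (μ ν : ProbabilityMeasure Ω) :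
    BddAbove (Set.range fun φ : {f : Ω → ℝ // LipschitzWith 1 f} =>
      (∫ x, φ.1 x ∂(μ : Measure Ω)) - ∫ x, φ.1 x ∂(ν : Measure Ω)) := by
  obtain ⟨x₀⟩ : Nonempty Ω := μ.nonempty
  refine ⟨2 * Metric.diam (Set.univ : Set Ω), ?_⟩
  rintro _ ⟨φ, rfl⟩
  have hφ (x : Ω) : |φ.1 x - φ.1 x₀| ≤ Metric.diam (Set.univ : Set Ω) := by
    have h := φ.2.dist_le_mul x x₀
    rw [Real.dist_eq, NNReal.coe_one, one_mul] at h
    exact h.trans (Metric.dist_le_diam_of_mem isCompact_univ.isBounded trivial trivial)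
  have hint (ρ : ProbabilityMeasure Ω) :=
    integrable_of_continuous_of_compactSpace ρ φ.2.continuous
  have h₁ : ∫ x, φ.1 x ∂(μ : Measure Ω) ≤ φ.1 x₀ + Metric.diam (Set.univ : Set Ω) := by
    simpa using integral_mono (hint μ) (integrable_const (φ.1 x₀ + Metric.diam Set.univ))
      fun x => by have := abs_le.1 (hφ x); dsimp only; linarith
  have h₂ : φ.1 x₀ - Metric.diam (Set.univ : Set Ω) ≤ ∫ x, φ.1 x ∂(ν : Measure Ω) := by
    simpa using integral_mono (integrable_const (φ.1 x₀ - Metric.diam Set.univ)) (hint ν)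
      fun x => by have := abs_le.1 (hφ x); dsimp only; linarith
  dsimp only
  linarith

theorem integral_sub_integral_le_krDist (μ ν : ProbabilityMeasure Ω) {φ : Ω → ℝ}
    (hφ : LipschitzWith 1 φ) :
    (∫ x, φ x ∂(μ : Measure Ω)) - ∫ x, φ x ∂(ν : Measure Ω) ≤ krDist μ ν :=
  le_ciSup (bddAbove_range_integral_sub_integral μ ν) ⟨φ, hφ⟩

theorem krDist_nonneg (μ ν : ProbabilityMeasure Ω) : 0 ≤ krDist μ ν := by
  simpa using integral_sub_integral_le_krDist μ ν (φ := fun _ => (0 : ℝ))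
    ((LipschitzWith.const 0).weaken zero_le_one)

theorem krDist_comm (μ ν : ProbabilityMeasure Ω) : krDist μ ν = krDist ν μ := by
  have key (μ ν : ProbabilityMeasure Ω) : krDist μ ν ≤ krDist ν μ := krDist_le fun φ hφ => by
    have := integral_sub_integral_le_krDist ν μ (φ := fun x => -φ x) hφ.neg
    simp only [integral_neg] at this
    linarith
  exact le_antisymm (key μ ν) (key ν μ)

theorem krDist_triangle (μ ν ρ : ProbabilityMeasure Ω) :
    krDist μ ρ ≤ krDist μ ν + krDist ν ρ := krDist_le fun φ hφ => by
  linarith [integral_sub_integral_le_krDist μ ν hφ, integral_sub_integral_le_krDist ν ρ hφ]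

theorem eventually_krDist_lt (μ : ProbabilityMeasure Ω) {ε : ℝ} (hε : 0 < ε) :
    ∀ᶠ ν in 𝓝 μ, krDist ν μ < ε := by
  obtain ⟨x₀⟩ : Nonempty Ω := μ.nonempty
  have h : ∀ᶠ ν : ProbabilityMeasure Ω in 𝓝 μ, ∀ f ∈ {f : Ω →ᵇ ℝ | LipschitzWith 1 f ∧ f x₀ = 0},
      (∫ x, f x ∂(ν : Measure Ω)) - ∫ x, f x ∂(μ : Measure Ω) < ε / 2 := by
    refine (isCompact_setOf_lipschitzWith_one x₀).eventually_forall_of_forall_eventually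
      fun f _ => ?_
    have hc : Continuous fun p : ProbabilityMeasure Ω × (Ω →ᵇ ℝ) =>
        (∫ x, p.2 x ∂(p.1 : Measure Ω)) - ∫ x, p.2 x ∂(μ : Measure Ω) :=
      continuous_integral_probabilityMeasure_prod.sub
        ((lipschitzWith_integral_boundedContinuousFunction μ).continuous.comp continuous_snd)
    exact (hc.tendsto (μ, f)).eventually_lt_const (by simpa using hε)
  filter_upwards [h] with ν hν
  refine lt_of_le_of_lt (krDist_le fun φ hφ => ?_) (half_lt_self hε)
  have hφ₀ : LipschitzWith 1 fun x => φ x - φ x₀ := by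
    refine LipschitzWith.of_dist_le_mul fun x y => ?_
    simpa using hφ.dist_le_mul x y
  have := hν (BoundedContinuousFunction.mkOfCompact ⟨_, hφ₀.continuous⟩) ⟨hφ₀, by simp⟩
  simp only [BoundedContinuousFunction.mkOfCompact_apply, ContinuousMap.coe_mk] at this
  rw [integral_sub (integrable_of_continuous_of_compactSpace ν hφ.continuous)
      (integrable_const _),
    integral_sub (integrable_of_continuous_of_compactSpace μ hφ.continuous)
      (integrable_const _)] at this
  simp only [integral_const, probReal_univ, one_smul] at this
  linarith

/-- Every probability measure is a weak limit of empirical measures. -/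
theorem exists_tendsto_empiricalProb (μ : ProbabilityMeasure Ω) :
    ∃ X : (M : ℕ) → Fin (M + 1) → Ω,
      Tendsto (fun M => empiricalProb (X M)) atTop (𝓝 μ) := by
  have := separableSpace_boundedContinuousFunction Ω
  let P : Measure (ℕ → Ω) := Measure.infinitePi fun _ => (μ : Measure Ω)
  have hslln (f : Ω →ᵇ ℝ) : ∀ᵐ w ∂P, Tendsto
      (fun n : ℕ => (∑ i ∈ Finset.range n, f (w i)) / n) atTop (𝓝 (∫ x, f x ∂(μ : Measure Ω))) := by
    have hmp (i : ℕ) : MeasurePreserving (fun w : ℕ → Ω => w i) P (μ : Measure Ω) :=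
      measurePreserving_eval_infinitePi _ i
    have hmf : Measurable f := f.continuous.measurable
    have hindep : ProbabilityTheory.iIndepFun (fun i (w : ℕ → Ω) => f (w i)) P :=
      ProbabilityTheory.iIndepFun_infinitePi (X := fun _ => f) fun _ => hmf
    have h := ProbabilityTheory.strong_law_ae_real (μ := P) (fun i w => f (w i))
      ((hmp 0).integrable_comp_of_integrable (f.integrable _))
      (fun i j hij => hindep.indepFun hij)
      (fun i => by
        refine ⟨(hmf.comp (hmp i).measurable).aemeasurable,
          (hmf.comp (hmp 0).measurable).aemeasurable, ?_⟩
        change P.map (f ∘ fun w : ℕ → Ω => w i) = P.map (f ∘ fun w : ℕ → Ω => w 0)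
        rw [← Measure.map_map hmf (hmp i).measurable, ← Measure.map_map hmf (hmp 0).measurable,
          (hmp i).map_eq, (hmp 0).map_eq])
    rwa [← (hmp 0).map_eq, integral_map (hmp 0).measurable.aemeasurable
      hmf.aestronglyMeasurable]
  obtain ⟨w, hw⟩ := (ae_all_iff.2 fun j =>
    hslln (TopologicalSpace.denseSeq (Ω →ᵇ ℝ) j)).exists
  refine ⟨fun M i => w i, ProbabilityMeasure.tendsto_iff_forall_integral_tendsto.2 fun f => ?_⟩
  have heq : Equicontinuous fun (M : ℕ) (f : Ω →ᵇ ℝ) =>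
      ∫ x, f x ∂(empiricalProb (fun i : Fin (M + 1) => w i) : Measure Ω) :=
    (LipschitzWith.uniformEquicontinuous _ 1 fun M =>
      lipschitzWith_integral_boundedContinuousFunction _).equicontinuous
  refine (TopologicalSpace.denseRange_denseSeq (Ω →ᵇ ℝ)).induction_on
    (p := fun f => Tendsto (fun M : ℕ =>
      ∫ x, f x ∂(empiricalProb (fun i : Fin (M + 1) => w i) : Measure Ω)) atTop
        (𝓝 (∫ x, f x ∂(μ : Measure Ω)))) f
    (heq.isClosed_setOfPred_tendsto
      (lipschitzWith_integral_boundedContinuousFunction μ).continuous) fun j => ?_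
  refine ((tendsto_add_atTop_iff_nat 1).2 (hw j)).congr fun M => ?_
  rw [integral_empiricalProb _ (BoundedContinuousFunction.continuous _).stronglyMeasurable,
    Finset.sum_range]

theorem exists_finite_krDist_net {δ : ℝ} (hδ : 0 < δ) :
    ∃ S : Finset (ProbabilityMeasure Ω), ∀ ν, ∃ μ ∈ S, krDist ν μ < δ := by
  obtain ⟨S, hS⟩ := finite_cover_nhds fun μ : ProbabilityMeasure Ω => eventually_krDist_lt μ hδ
  refine ⟨S, fun ν => ?_⟩
  have : ν ∈ ⋃ μ ∈ S, {ν | krDist ν μ < δ} := hS ▸ Set.mem_univ ν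
  simpa using this

theorem continuous_of_krDist_modulus {U : ProbabilityMeasure Ω → ℝ}
    (h : ∀ ε > 0, ∃ δ > 0, ∀ μ ν, krDist μ ν < δ → |U μ - U ν| ≤ ε) : Continuous U := by
  refine continuous_iff_continuousAt.2 fun μ => Metric.tendsto_nhds.2 fun ε hε => ?_
  obtain ⟨δ, hδ, hU⟩ := h (ε / 2) (half_pos hε)
  filter_upwards [eventually_krDist_lt μ hδ] with ν hν
  exact (hU ν μ hν).trans_lt (half_lt_self hε)

/-- A uniformly bounded family of functions of `M` points, uniformly equicontinuous for the
Kantorovich–Rubinstein distance of empirical measures, is uniformly close, along any ultrafilter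
finer than `atTop`, to a continuous function of the empirical measure. -/
theorem exists_continuous_eventually_sub_empiricalProb_le
    (u : (M : ℕ) → (Fin (M + 1) → Ω) → ℝ) {C : ℝ} (hC : ∀ (M : ℕ) X, |u M X| ≤ C)
    (hu : ∀ ε > 0, ∃ δ > 0, ∀ M X Y,
      krDist (empiricalProb X) (empiricalProb Y) < δ → |u M X - u M Y| ≤ ε)
    (𝒰 : Ultrafilter ℕ) (h𝒰 : (𝒰 : Filter ℕ) ≤ atTop) :
    ∃ U : ProbabilityMeasure Ω → ℝ, Continuous U ∧
      ∀ ε > 0, ∀ᶠ M in (𝒰 : Filter ℕ), ∀ X, |u M X - U (empiricalProb X)| ≤ ε := by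
  choose X hX using exists_tendsto_empiricalProb (Ω := Ω)
  have hlim (μ : ProbabilityMeasure Ω) :
      ∃ a, Tendsto (fun M => u M (X μ M)) (𝒰 : Filter ℕ) (𝓝 a) := by
    obtain ⟨a, -, ha⟩ := (isCompact_Icc (a := -C) (b := C)).ultrafilter_le_nhds
      (𝒰.map fun M => u M (X μ M))
      (le_principal_iff.2 (mem_map.2 (univ_mem' fun M => abs_le.1 (hC M _))))
    exact ⟨a, ha⟩
  choose U hU using hlim
  have hclose (μ : ProbabilityMeasure Ω) {δ : ℝ} (hδ : 0 < δ) :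
      ∀ᶠ M in (𝒰 : Filter ℕ), krDist (empiricalProb (X μ M)) μ < δ :=
    ((hX μ).mono_left h𝒰).eventually (eventually_krDist_lt μ hδ)
  have hmodU : ∀ ε > 0, ∃ δ > 0, ∀ μ ν, krDist μ ν < δ → |U μ - U ν| ≤ ε := by
    intro ε hε
    obtain ⟨δ, hδ, h⟩ := hu ε hε
    refine ⟨δ / 3, by positivity, fun μ ν hμν => ?_⟩
    refine le_of_tendsto ((hU μ).sub (hU ν)).abs ?_
    filter_upwards [hclose μ (by positivity : 0 < δ / 3),
      hclose ν (by positivity : 0 < δ / 3)] with M hμ hν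
    refine h M _ _ ?_
    have h₁ := krDist_triangle (empiricalProb (X μ M)) μ (empiricalProb (X ν M))
    have h₂ := krDist_triangle μ ν (empiricalProb (X ν M))
    rw [krDist_comm ν] at h₂
    linarith
  refine ⟨U, continuous_of_krDist_modulus hmodU, fun ε hε => ?_⟩
  obtain ⟨δ₁, hδ₁, h₁⟩ := hu (ε / 3) (by positivity)
  obtain ⟨δ₂, hδ₂, h₂⟩ := hmodU (ε / 3) (by positivity)
  obtain ⟨S, hS⟩ := exists_finite_krDist_net (Ω := Ω)
    (lt_min (half_pos hδ₁) hδ₂ : 0 < min (δ₁ / 2) δ₂)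
  have hev : ∀ᶠ M in (𝒰 : Filter ℕ), ∀ μ ∈ S,
      krDist (empiricalProb (X μ M)) μ < δ₁ / 2 ∧ |u M (X μ M) - U μ| < ε / 3 :=
    (eventually_all_finset S).2 fun μ _ => (hclose μ (half_pos hδ₁)).and
      ((hU μ).eventually (Metric.ball_mem_nhds _ (by positivity : 0 < ε / 3)))
  filter_upwards [hev] with M hM Y
  obtain ⟨μ, hμS, hμ⟩ := hS (empiricalProb Y)
  obtain ⟨hd, hUμ⟩ := hM μ hμS
  have hY : |u M Y - u M (X μ M)| ≤ ε / 3 := by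
    refine h₁ M _ _ ((krDist_triangle _ μ _).trans_lt ?_)
    rw [krDist_comm μ]
    linarith [hμ.trans_le (min_le_left _ _)]
  have hV : |U (empiricalProb Y) - U μ| ≤ ε / 3 := h₂ _ _ (hμ.trans_le (min_le_right _ _))
  rw [abs_le] at hY hV ⊢
  rw [abs_lt] at hUμ
  constructor <;> linarith

end CompactMetric

/-- Theorem A.1 (Cardaliaguet, Theorem 2.1): a uniformly bounded sequence of symmetric
functions `u_M : Q^M → ℝ`, with common modulus of continuity `ω` with respect to the
Kantorovich–Rubinstein distance of empirical measures, admits a subsequence converging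
uniformly to a continuous function `U` on the probability measures on `Q` (with the
topology of weak convergence), in the sense `sup_X |u_{M_k}(X) − U(m^{M_k}_X)| → 0`. -/
theorem cardaliaguet_mean_field_limit
    (Q : Set ℝ) (hQne : Q.Nonempty) (hQc : IsCompact Q)
    (u : (M : ℕ) → (Fin (M + 1) → Q) → ℝ)
    (hsym : ∀ (M : ℕ) (X : Fin (M + 1) → Q) (σ : Equiv.Perm (Fin (M + 1))),
      u M (X ∘ σ) = u M X)
    (hbdd : ∃ C : ℝ, ∀ (M : ℕ) (X : Fin (M + 1) → Q), |u M X| ≤ C)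
    (ω : ℝ → ℝ) (hω_mono : MonotoneOn ω (Set.Ici (0 : ℝ))) (hω0 : ω 0 = 0)
    (hω_nonneg : ∀ t, 0 ≤ t → 0 ≤ ω t)
    (hω_cont : ContinuousWithinAt ω (Set.Ici (0 : ℝ)) 0)
    (hmod : ∀ (M : ℕ) (X Y : Fin (M + 1) → Q),
      |u M X - u M Y| ≤ ω (krDist (empiricalProb X) (empiricalProb Y))) :
    ∃ Msub : ℕ → ℕ, StrictMono Msub ∧
      ∃ U : ProbabilityMeasure Q → ℝ, Continuous U ∧
        Tendsto (fun k => ⨆ X : Fin (Msub k + 1) → Q,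
            |u (Msub k) X - U (empiricalProb X)|)
          atTop (nhds 0) := by
  obtain ⟨C, hC⟩ := hbdd
  have : CompactSpace Q := isCompact_iff_compactSpace.1 hQc
  have hu : ∀ ε > 0, ∃ δ > 0, ∀ M X Y,
      krDist (empiricalProb X) (empiricalProb Y) < δ → |u M X - u M Y| ≤ ε := by
    intro ε hε
    obtain ⟨δ, hδ, h⟩ := Metric.continuousWithinAt_iff.1 hω_cont ε hε
    refine ⟨δ, hδ, fun M X Y hXY => (hmod M X Y).trans ?_⟩
    have hnn := krDist_nonneg (empiricalProb X) (empiricalProb Y)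
    have hlt := h (Set.mem_Ici.2 hnn) (by rwa [Real.dist_eq, sub_zero, abs_of_nonneg hnn])
    rw [hω0, Real.dist_eq, sub_zero] at hlt
    exact (le_abs_self _).trans hlt.le
  obtain ⟨U, hUc, hU⟩ := exists_continuous_eventually_sub_empiricalProb_le u hC hu
    (hyperfilter ℕ) Nat.hyperfilter_le_atTop
  obtain ⟨Msub, hMsub, hsub⟩ := extraction_forall_of_frequently
    (P := fun n M => ∀ X, |u M X - U (empiricalProb X)| ≤ 1 / ((n : ℝ) + 1)) fun n =>
      (hU _ Nat.one_div_pos_of_nat).frequently.filter_mono Nat.hyperfilter_le_atTop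
  have : Nonempty Q := hQne.to_subtype
  exact ⟨Msub, hMsub, U, hUc, squeeze_zero
    (fun k => Real.iSup_nonneg fun X => abs_nonneg _)
    (fun k => ciSup_le (hsub k)) tendsto_one_div_add_atTop_nhds_zero_nat⟩
end

section
/- Let ν > 0 and Y_0 ∈ ℝ. Define Y_{n+1} = (1 − 1/(1+ν)) Y_n, u_n = Y_n/(1+ν), C = 1 + ν/(1+ν)^2, σ = (1 − 1/(1+ν))^2, and the receding-horizon cost of length one Ṽ(Y_0) = Σ_{n=0}^{1} ( (1/2) Y_n^2 + (ν/2) u_n^2 ). Set α = 1 − (Cσ)^2 and assume α > 0. Then Ṽ(Y_0) ≥ Ṽ(Y_1) + α · ( (1/2) Y_0^2 + (ν/2) u_0^2 ). -/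
open Finset

/-- Concluding inequality of Example 3.2, for the scalar mean dynamics of the
alignment model: with the instantaneous MPC feedback `u_n = Y_n/(1+ν)` and
receding-horizon cost of length one
`Ṽ(z) = Σ_{n=0}^{1} ((1/2)Y_n² + (ν/2)u_n²)` along the loop started at `z`,
the relaxed dynamic-programming inequality
`Ṽ(Y₀) ≥ Ṽ(Y₁) + α ((1/2)Y₀² + (ν/2)u₀²)` holds for `α = 1 − (Cσ)²`, provided
`α > 0`, where `C = 1 + ν/(1+ν)²` and `σ = (1 − 1/(1+ν))²`. -/
theorem two_step_receding_horizon_inequality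
    (ν : ℝ) (hν : 0 < ν) (Y : ℕ → ℝ)
    (hY : ∀ n, Y (n + 1) = (1 - 1 / (1 + ν)) * Y n)
    (u : ℕ → ℝ) (hu : ∀ n, u n = Y n / (1 + ν))
    (C σ : ℝ) (hC : C = 1 + ν / (1 + ν) ^ 2) (hσ : σ = (1 - 1 / (1 + ν)) ^ 2)
    (Vtil : ℝ → ℝ)
    (hVtil : ∀ z : ℝ,
      Vtil z = ((1 / 2) * z ^ 2 + (ν / 2) * (z / (1 + ν)) ^ 2) +
        ((1 / 2) * ((1 - 1 / (1 + ν)) * z) ^ 2 +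
          (ν / 2) * (((1 - 1 / (1 + ν)) * z) / (1 + ν)) ^ 2))
    (α : ℝ) (hα : α = 1 - (C * σ) ^ 2) (hαpos : 0 < α) :
    Vtil (Y 0) ≥ Vtil (Y 1) + α * ((1 / 2) * (Y 0) ^ 2 + (ν / 2) * (u 0) ^ 2) := by
  have hC1 : 1 ≤ C := by
    have : 0 ≤ ν / (1 + ν) ^ 2 := by positivity
    linarith
  have hV : ∀ z, Vtil z = (1 + σ) * (C / 2) * z ^ 2 := fun z => by
    rw [hVtil, hσ, hC]
    field
  have hY1 : Y 1 ^ 2 = σ * Y 0 ^ 2 := by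
    rw [hY 0, hσ]
    ring
  have hcost : (1 / 2) * (Y 0) ^ 2 + (ν / 2) * (u 0) ^ 2 = C / 2 * Y 0 ^ 2 := by
    rw [hu, hC]
    field
  have hgap : 0 ≤ (C ^ 2 - 1) * σ ^ 2 * (C / 2 * Y 0 ^ 2) := by
    have : 0 ≤ C ^ 2 - 1 := by nlinarith
    positivity
  rw [hV, hV, hY1, hcost, hα]
  linarith
end
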